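/- Let k ≥ 0, ℓ ≥ 1 and let λ ∈ P_ℓ^k satisfy: for every x with 2 ≤ x ≤ ℓ and k − λ_x + x < ℓ, one has λ_{x−1} > λ_x (i.e. λ ∈ Ŝ_ℓ^k). Then there exists a finitely supported family of integers (b_μ) indexed by μ ∈ P_ℓ^k such that 𝔤_λ^{(k)} = ∑_{μ ∈ P_ℓ^k} b_μ · g_μ^{(k)} in R, and (−1)^{|λ|−|μ|} · b_μ ≥ 0 for every μ ∈ P_ℓ^k. -/

import Mathlib

open scoped Classical

noncomputable section

/-- The ambient ring: formal power series over ℚ in countably many variables. -/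
abbrev R : Type := MvPowerSeries ℕ ℚ

/-- The complete homogeneous symmetric function `h_m` (equal to `0` for `m < 0`):
its coefficient at a monomial is `1` if the monomial has total degree `m`, else `0`. -/
def hh (m : ℤ) : R := fun d => if ((d.sum fun _ e => (e : ℤ)) = m) then 1 else 0

/-- The inhomogeneous analogue `k_m^{(r)} = ∑_{i=0}^{m} C(r+i−1, i) · h_{m−i}`. -/
def kk (r : ℕ) (m : ℤ) : R :=
  ∑ i ∈ Finset.range (m.toNat + 1), ((r + i - 1).choose i : ℚ) • hh (m - (i : ℤ))

/-- The dual stable Grothendieck polynomial `g_γ`, as an `ℓ × ℓ` determinant with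
`(i,j)` entry `k_{γ_i + j − i}^{(i−1)}` (indices 1-based). -/
def gg (ℓ : ℕ) (γ : ℕ → ℤ) : R :=
  (Matrix.of fun i j : Fin ℓ =>
    kk i.val (γ (i.val + 1) + (j.val : ℤ) - (i.val : ℤ))).det

/-- The `i`-th standard basis vector `ε_i`. -/
def eps (i : ℕ) : ℕ → ℤ := fun x => if x = i then 1 else 0

/-- The Katalan function `K(Ψ; M; γ)`. -/
def katalan (ℓ : ℕ) (Ψ : Finset (ℕ × ℕ)) (M : Multiset ℕ) (γ : ℕ → ℤ) : R :=
  (M.powerset.map fun S =>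
    (-1 : R) ^ Multiset.card S *
      ∑ᶠ α : {p // p ∈ Ψ} → ℕ,
        gg ℓ (fun x =>
          γ x + (∑ p ∈ Ψ.attach, (α p : ℤ) * (eps p.1.1 x - eps p.1.2 x))
            - (S.map fun z => eps z x).sum)).sum

/-- The set of positive roots `Δ_ℓ^+ = {(i,j) : 1 ≤ i < j ≤ ℓ}`. -/
def DeltaPlus (ℓ : ℕ) : Finset (ℕ × ℕ) :=
  (Finset.Icc 1 ℓ ×ˢ Finset.Icc 1 ℓ).filter fun p => p.1 < p.2

/-- A root ideal: an upper order ideal of `Δ_ℓ^+`. -/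
def IsRootIdeal (ℓ : ℕ) (Ψ : Finset (ℕ × ℕ)) : Prop :=
  Ψ ⊆ DeltaPlus ℓ ∧
    ∀ a b c d : ℕ, (a, b) ∈ Ψ → (c, d) ∈ DeltaPlus ℓ → c ≤ a → b ≤ d → (c, d) ∈ Ψ

/-- The root ideal `Δ^k(λ) = {(i,j) ∈ Δ_ℓ^+ : j > k − λ_i + i}`. -/
def DeltaK (k ℓ : ℕ) (lam : ℕ → ℤ) : Finset (ℕ × ℕ) :=
  (DeltaPlus ℓ).filter fun p => (k : ℤ) - lam p.1 + (p.1 : ℤ) < (p.2 : ℤ)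

/-- `bot(Ψ)`: the largest `x` such that row `x` of `Ψ` is nonempty (`0` if `Ψ = ∅`). -/
def botIdeal (Ψ : Finset (ℕ × ℕ)) : ℕ := Ψ.sup Prod.fst

/-- `bot_λ := bot(Δ^k(λ))`. -/
def botL (k ℓ : ℕ) (lam : ℕ → ℤ) : ℕ := botIdeal (DeltaK k ℓ lam)

/-- A removable root of a root ideal. -/
def IsRemovable (ℓ : ℕ) (Ψ : Finset (ℕ × ℕ)) (α : ℕ × ℕ) : Prop :=
  α ∈ Ψ ∧ IsRootIdeal ℓ (Ψ.erase α)

/-- `down_Ψ(x)` is defined, i.e. row `x` of `Ψ` contains a removable root. -/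
def HasDown (ℓ : ℕ) (Ψ : Finset (ℕ × ℕ)) (x : ℕ) : Prop :=
  ∃ j, IsRemovable ℓ Ψ (x, j)

/-- `down_Ψ(x)`: the column of the removable root in row `x` (junk value `0` if
row `x` has no removable root). -/
def down (ℓ : ℕ) (Ψ : Finset (ℕ × ℕ)) (x : ℕ) : ℕ :=
  ((Ψ.filter fun p => p.1 = x ∧ IsRemovable ℓ Ψ p).image Prod.snd).sup id

/-- `down_λ := down_{Δ^k(λ)}`. -/
def downL (k ℓ : ℕ) (lam : ℕ → ℤ) : ℕ → ℕ := down ℓ (DeltaK k ℓ lam)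

/-- The `a`-fold iterate `down_Ψ^a(x)` is defined. -/
def DownIterDefined (ℓ : ℕ) (Ψ : Finset (ℕ × ℕ)) (a x : ℕ) : Prop :=
  ∀ b < a, HasDown ℓ Ψ ((down ℓ Ψ)^[b] x)

/-- `L(ℛ)`: the multiset of second components of `ℛ`, with multiplicity. -/
def Lmul (ℛ : Finset (ℕ × ℕ)) : Multiset ℕ := ℛ.val.map Prod.snd

/-- `λ ∈ P_ℓ^k`: a `k`-bounded partition with `ℓ` parts allowed to be zero. -/
def IsKBounded (k ℓ : ℕ) (lam : ℕ → ℤ) : Prop :=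
  lam 1 ≤ (k : ℤ) ∧ (∀ i, 1 ≤ i → i < ℓ → lam (i + 1) ≤ lam i) ∧ 0 ≤ lam ℓ

/-- The multiset `M_z(λ)`: `L(Δ^k(λ))` with one occurrence of `down_λ(x)` removed
for each `x ∈ [z, bot_λ]`. -/
def Mz (k ℓ : ℕ) (lam : ℕ → ℤ) (z : ℕ) : Multiset ℕ :=
  Lmul (DeltaK k ℓ lam) - ((Finset.Icc z (botL k ℓ lam)).val.map (downL k ℓ lam))

/-- The `K`-`k`-Schur function of weight `z`: `ĝ_λ^{(z)} = K(Δ^k(λ); M_z(λ); λ)`. -/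
def wkschur (k ℓ : ℕ) (lam : ℕ → ℤ) (z : ℕ) : R :=
  katalan ℓ (DeltaK k ℓ lam) (Mz k ℓ lam z) lam

/-- The `K`-`k`-Schur function `g_λ^{(k)} = K(Δ^k(λ); L(Δ^{k+1}(λ)); λ)`. -/
def kkschur (k ℓ : ℕ) (lam : ℕ → ℤ) : R :=
  katalan ℓ (DeltaK k ℓ lam) (Lmul (DeltaK (k + 1) ℓ lam)) lam

/-- The closed `k`-Schur Katalan function `𝔤_λ^{(k)} = K(Δ^k(λ); L(Δ^k(λ)); λ)`. -/
def closedkschur (k ℓ : ℕ) (lam : ℕ → ℤ) : R :=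
  katalan ℓ (DeltaK k ℓ lam) (Lmul (DeltaK k ℓ lam)) lam

/-- `|λ| = λ_1 + ⋯ + λ_ℓ`. -/
def psize (ℓ : ℕ) (lam : ℕ → ℤ) : ℤ := ∑ i ∈ Finset.Icc 1 ℓ, lam i

lemma hh_of_neg {m : ℤ} (hm : m < 0) : hh m = 0 := by
  funext d
  have h0 : 0 ≤ d.sum fun _ e => (e : ℤ) := Finset.sum_nonneg fun _ _ => Int.natCast_nonneg _
  have hne : (d.sum fun _ e => (e : ℤ)) ≠ m := by omega
  simp only [hh, if_neg hne]
  rfl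

lemma kk_of_neg (r : ℕ) {m : ℤ} (hm : m < 0) : kk r m = 0 :=
  Finset.sum_eq_zero fun i _ => by rw [hh_of_neg (by omega), smul_zero]

lemma kk_succ (r : ℕ) (m : ℤ) : kk (r + 1) m = kk r m + kk (r + 1) (m - 1) := by
  rcases lt_or_ge m 0 with hm | hm
  · rw [kk_of_neg _ hm, kk_of_neg _ hm, kk_of_neg _ (by omega), add_zero]
  obtain ⟨n, rfl⟩ := Int.eq_ofNat_of_zero_le hm
  rcases n with _ | n
  · have h0 : ((0 : ℕ) : ℤ) - 1 < 0 := by norm_num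
    rw [kk_of_neg (r + 1) h0]
    simp [kk]
  · have hcast : ((n + 1 : ℕ) : ℤ) - 1 = n := by push_cast; ring
    rw [hcast]
    simp only [kk, Int.toNat_natCast]
    rw [Finset.sum_range_succ', Finset.sum_range_succ' (fun i =>
      (((r + i - 1).choose i : ℕ) : ℚ) • hh (((n + 1 : ℕ) : ℤ) - (i : ℤ))) (n + 1),
      add_right_comm (Finset.sum _ _), ← Finset.sum_add_distrib]
    congr 1
    · refine Finset.sum_congr rfl fun i _ => ?_
      have hh_eq : ((n + 1 : ℕ) : ℤ) - ((i + 1 : ℕ) : ℤ) = (n : ℤ) - i := by push_cast; ring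
      rw [hh_eq, ← add_smul]
      congr 1
      have h1 : r + 1 + (i + 1) - 1 = (r + i) + 1 := by omega
      have h2 : r + (i + 1) - 1 = r + i := by omega
      have h3 : r + 1 + i - 1 = r + i := by omega
      rw [h1, h2, h3, Nat.choose_succ_succ]
      push_cast
      ring
    · simp

lemma gg_eq_zero {ℓ : ℕ} {γ : ℕ → ℤ} {x : ℕ} (h1 : 1 ≤ x) (h2 : x ≤ ℓ) (h : γ x + ℓ < x) :
    gg ℓ γ = 0 := by
  refine Matrix.det_eq_zero_of_row_eq_zero ⟨x - 1, by omega⟩ fun j => kk_of_neg _ ?_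
  have hj := j.2
  have hx : x - 1 + 1 = x := by omega
  simp only [hx]
  push_cast [h1]
  omega

/-- The dot action of the simple transposition exchanging `c` and `c + 1`. -/
def dotSwap (c : ℕ) (γ : ℕ → ℤ) : ℕ → ℤ := fun x =>
  γ (Equiv.swap c (c + 1) x) + (eps (c + 1) x - eps c x)

/-- `(1 - L_c) f`. -/
def lowerDiff (c : ℕ) (f : (ℕ → ℤ) → R) (γ : ℕ → ℤ) : R :=
  f γ - f fun x => γ x - eps c x

lemma lowerDiff_gg_dotSwap {ℓ c : ℕ} (hc : 1 ≤ c) (hcl : c + 1 ≤ ℓ) (γ : ℕ → ℤ) :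
    lowerDiff (c + 1) (gg ℓ) (dotSwap c γ) = - lowerDiff (c + 1) (gg ℓ) γ := by
  obtain ⟨n, rfl⟩ : ∃ n, c = n + 1 := ⟨c - 1, by omega⟩
  let i0 : Fin ℓ := ⟨n, by omega⟩
  let i1 : Fin ℓ := ⟨n + 1, by omega⟩
  have hne : i0 ≠ i1 := by simp [i0, i1, Fin.ext_iff]
  let A : (ℕ → ℤ) → Matrix (Fin ℓ) (Fin ℓ) R := fun γ => Matrix.of fun i j : Fin ℓ =>
    kk i.val (γ (i.val + 1) + (j.val : ℤ) - (i.val : ℤ))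
  have hgg : ∀ γ, gg ℓ γ = (A γ).det := fun _ => rfl
  let u : (ℕ → ℤ) → Fin ℓ → R := fun γ j => kk n (γ (n + 1 + 1) + (j.val : ℤ) - ((n + 1 : ℕ) : ℤ))
  have key : ∀ γ, lowerDiff (n + 1 + 1) (gg ℓ) γ = ((A γ).updateRow i1 (u γ)).det := by
    intro γ
    let v : Fin ℓ → R := fun j =>
      kk (n + 1) (γ (n + 1 + 1) + (j.val : ℤ) - ((n + 1 : ℕ) : ℤ) - 1)
    have hA : (A γ).updateRow i1 (u γ + v) = A γ := by
      ext1 i j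
      by_cases hi : i = i1
      · subst hi
        rw [Matrix.updateRow_self]
        exact (kk_succ n _).symm
      · rw [Matrix.updateRow_ne hi]
    have hB : (A γ).updateRow i1 v = A fun x => γ x - eps (n + 1 + 1) x := by
      ext1 i j
      by_cases hi : i = i1
      · subst hi
        rw [Matrix.updateRow_self]
        simp only [v, A, i1, Matrix.of_apply, eps, if_true]
        congr 1
        ring
      · rw [Matrix.updateRow_ne hi]
        have : ¬ i.val + 1 = n + 1 + 1 := fun h => hi (Fin.ext (by simp only [i1]; omega))
        simp only [A, Matrix.of_apply, eps, if_neg this, sub_zero]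
    have h := Matrix.det_updateRow_add (A γ) i1 (u γ) v
    rw [hA, hB] at h
    rw [lowerDiff, hgg, hgg, h, add_sub_cancel_right]
  rw [key, key]
  have hperm : (A (dotSwap (n + 1) γ)).updateRow i1 (u (dotSwap (n + 1) γ)) =
      ((A γ).updateRow i1 (u γ)).submatrix (Equiv.swap i0 i1) id := by
    ext1 i j
    rw [Matrix.submatrix_apply, id]
    by_cases h0 : i = i0
    · subst h0
      rw [Matrix.updateRow_ne hne, Equiv.swap_apply_left, Matrix.updateRow_self]
      simp only [A, u, i0, Matrix.of_apply, dotSwap, eps, Equiv.swap_apply_left]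
      congr 1
      simp
      ring
    by_cases h1 : i = i1
    · subst h1
      rw [Equiv.swap_apply_right, Matrix.updateRow_self, Matrix.updateRow_ne hne]
      simp only [A, u, i0, Matrix.of_apply, dotSwap, eps, Equiv.swap_apply_right]
      congr 1
      simp
      ring
    · rw [Equiv.swap_apply_of_ne_of_ne h0 h1, Matrix.updateRow_ne h1, Matrix.updateRow_ne h1]
      have e0 : i.val + 1 ≠ n + 1 := fun h => h0 (Fin.ext (by simp only [i0]; omega))
      have e1 : i.val + 1 ≠ n + 1 + 1 := fun h => h1 (Fin.ext (by simp only [i1]; omega))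
      simp only [A, Matrix.of_apply, dotSwap, eps, Equiv.swap_apply_of_ne_of_ne e0 e1, if_neg e0,
        if_neg e1, sub_zero, add_zero]
  rw [hperm, Matrix.det_permute, Equiv.Perm.sign_swap hne]
  simp

/-- The displacement `∑_p α_p (ε_{p.1} - ε_{p.2})`. -/
def rootShift (Ψ : Finset (ℕ × ℕ)) (α : {p // p ∈ Ψ} → ℕ) (x : ℕ) : ℤ :=
  ∑ p ∈ Ψ.attach, (α p : ℤ) * (eps p.1.1 x - eps p.1.2 x)

/-- `∏_{(i,j) ∈ Ψ} (1 - R_{ij})⁻¹ f`. -/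
def rootSum (f : (ℕ → ℤ) → R) (Ψ : Finset (ℕ × ℕ)) (γ : ℕ → ℤ) : R :=
  ∑ᶠ α : {p // p ∈ Ψ} → ℕ, f fun x => γ x + rootShift Ψ α x

lemma finite_support_gg {ℓ : ℕ} {Ψ : Finset (ℕ × ℕ)} (hΨ : Ψ ⊆ DeltaPlus ℓ) (γ : ℕ → ℤ) :
    (Function.support fun α : {p // p ∈ Ψ} → ℕ =>
      gg ℓ fun x => γ x + rootShift Ψ α x).Finite := by
  let B : ℤ := ∑ x ∈ Finset.Icc 1 ℓ, (x : ℤ) * (γ x + ℓ)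
  refine (Set.finite_Iic (fun _ : {p // p ∈ Ψ} => B.toNat)).subset fun α hα p => ?_
  have hrow : ∀ x ∈ Finset.Icc 1 ℓ, 0 ≤ (x : ℤ) * (γ x + rootShift Ψ α x + ℓ) := by
    intro x hx
    rw [Finset.mem_Icc] at hx
    by_contra hlt
    have : γ x + rootShift Ψ α x + ℓ < x := by
      by_contra h
      exact hlt (mul_nonneg (by positivity) (by omega))
    exact hα (gg_eq_zero hx.1 hx.2 this)
  have hsum : 0 ≤ ∑ x ∈ Finset.Icc 1 ℓ, (x : ℤ) * (γ x + rootShift Ψ α x + ℓ) :=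
    Finset.sum_nonneg hrow
  have hsplit : ∑ x ∈ Finset.Icc 1 ℓ, (x : ℤ) * (γ x + rootShift Ψ α x + ℓ) =
      B + ∑ q ∈ Ψ.attach, (α q : ℤ) * (q.1.1 - q.1.2) := by
    have heps : ∀ i ∈ Finset.Icc 1 ℓ, ∑ x ∈ Finset.Icc 1 ℓ, (x : ℤ) * eps i x = i := by
      intro i hi
      simp only [eps, mul_ite, mul_one, mul_zero, Finset.sum_ite_eq', hi, if_true]
    have : ∑ x ∈ Finset.Icc 1 ℓ, (x : ℤ) * rootShift Ψ α x =
        ∑ q ∈ Ψ.attach, (α q : ℤ) * (q.1.1 - q.1.2) := by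
      simp only [rootShift, Finset.mul_sum]
      rw [Finset.sum_comm]
      refine Finset.sum_congr rfl fun q _ => ?_
      have hq := hΨ q.2
      simp only [DeltaPlus, Finset.mem_filter, Finset.mem_product] at hq
      rw [← heps _ hq.1.1, ← heps _ hq.1.2, ← Finset.sum_sub_distrib, Finset.mul_sum]
      exact Finset.sum_congr rfl fun x _ => by ring
    rw [← this, ← Finset.sum_add_distrib]
    exact Finset.sum_congr rfl fun x _ => by ring
  have hle : ∑ q ∈ Ψ.attach, (α q : ℤ) * (q.1.1 - q.1.2) ≤ ∑ q ∈ Ψ.attach, -(α q : ℤ) := by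
    refine Finset.sum_le_sum fun q _ => ?_
    have hq := hΨ q.2
    simp only [DeltaPlus, Finset.mem_filter] at hq
    have : ((q.1.1 : ℤ) - q.1.2) ≤ -1 := by have := hq.2; omega
    nlinarith [Int.natCast_nonneg (α q)]
  have hp : (α p : ℤ) ≤ ∑ q ∈ Ψ.attach, (α q : ℤ) :=
    Finset.single_le_sum (f := fun q => (α q : ℤ)) (fun q _ => Int.natCast_nonneg _)
      (Finset.mem_attach _ p)
  rw [Finset.sum_neg_distrib] at hle
  change α p ≤ B.toNat
  omega

lemma rootSum_insert {ℓ : ℕ} {Ψ : Finset (ℕ × ℕ)} {p : ℕ × ℕ}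
    (hΨ : insert p Ψ ⊆ DeltaPlus ℓ) (hp : p ∉ Ψ) (γ : ℕ → ℤ) :
    rootSum (gg ℓ) (insert p Ψ) γ = rootSum (gg ℓ) Ψ γ +
      rootSum (gg ℓ) (insert p Ψ) (fun x => γ x + (eps p.1 x - eps p.2 x)) := by
  let p' : {q // q ∈ insert p Ψ} := ⟨p, Finset.mem_insert_self _ _⟩
  let F : ({q // q ∈ insert p Ψ} → ℕ) → R := fun α =>
    gg ℓ fun x => γ x + rootShift (insert p Ψ) α x
  have hfin : (Function.support F).Finite := finite_support_gg hΨ γ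
  let e0 : ({q // q ∈ Ψ} → ℕ) → {q // q ∈ insert p Ψ} → ℕ := fun α q =>
    if h : q.1 ∈ Ψ then α ⟨q.1, h⟩ else 0
  let e1 : ({q // q ∈ insert p Ψ} → ℕ) → {q // q ∈ insert p Ψ} → ℕ := fun α =>
    α + Pi.single p' 1
  have he0 : Function.Injective e0 := by
    intro α β h
    funext q
    have := congrFun h ⟨q.1, Finset.mem_insert_of_mem q.2⟩
    simpa [e0, q.2] using this
  have he1 : Function.Injective e1 := fun α β h => add_right_cancel h
  have hdisj : Disjoint (Set.range e0) (Set.range e1) := by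
    rw [Set.disjoint_left]
    rintro _ ⟨α, rfl⟩ ⟨β, h⟩
    have := congrFun h p'
    simp [e0, e1, p', hp] at this
  have hunion : Set.range e0 ∪ Set.range e1 = Set.univ := by
    refine Set.eq_univ_of_forall fun α => ?_
    by_cases h0 : α p' = 0
    · left
      refine ⟨fun q => α ⟨q.1, Finset.mem_insert_of_mem q.2⟩, funext fun q => ?_⟩
      by_cases hq : q.1 ∈ Ψ
      · simp [e0, hq]
      · have : q = p' := Subtype.ext ((Finset.mem_insert.1 q.2).resolve_right hq)
        simp only [e0, dif_neg hq]
        rw [this, h0]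
    · right
      refine ⟨fun q => α q - (Pi.single p' 1 : {q // q ∈ insert p Ψ} → ℕ) q, funext fun q => ?_⟩
      by_cases hq : q = p'
      · subst hq
        simp only [e1, Pi.add_apply, Pi.single_eq_same]
        omega
      · simp [e1, hq]
  have hs0 : ∀ α x, rootShift (insert p Ψ) (e0 α) x = rootShift Ψ α x := by
    intro α x
    let a : ℕ × ℕ → ℤ := fun q => if h : q ∈ Ψ then (α ⟨q, h⟩ : ℤ) else 0
    have h1 : rootShift (insert p Ψ) (e0 α) x =
        ∑ q ∈ (insert p Ψ).attach, a q.1 * (eps q.1.1 x - eps q.1.2 x) := by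
      refine Finset.sum_congr rfl fun q _ => ?_
      by_cases hq : q.1 ∈ Ψ <;> simp [e0, a, hq]
    have h2 : rootShift Ψ α x = ∑ q ∈ Ψ.attach, a q.1 * (eps q.1.1 x - eps q.1.2 x) :=
      Finset.sum_congr rfl fun q _ => by simp [a]
    rw [h1, h2, Finset.sum_attach (insert p Ψ) fun q => a q * (eps q.1 x - eps q.2 x),
      Finset.sum_attach Ψ fun q => a q * (eps q.1 x - eps q.2 x), Finset.sum_insert hp]
    simp [a, hp]
  have hs1 : ∀ α x, rootShift (insert p Ψ) (e1 α) x =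
      (eps p.1 x - eps p.2 x) + rootShift (insert p Ψ) α x := by
    intro α x
    have hsingle : ∑ q ∈ (insert p Ψ).attach,
        ((Pi.single p' 1 : {q // q ∈ insert p Ψ} → ℕ) q : ℤ) * (eps q.1.1 x - eps q.1.2 x) =
        eps p.1 x - eps p.2 x := by
      rw [Finset.sum_eq_single p']
      · simp [p']
      · intro q _ hq
        simp [hq]
      · intro h
        exact absurd (Finset.mem_attach _ p') h
    rw [← hsingle, rootShift, rootShift, ← Finset.sum_add_distrib]
    refine Finset.sum_congr rfl fun q _ => ?_
    simp only [e1, Pi.add_apply]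
    push_cast
    ring
  have hF : rootSum (gg ℓ) (insert p Ψ) γ = ∑ᶠ α ∈ Set.range e0 ∪ Set.range e1, F α := by
    rw [hunion, finsum_mem_univ]
    rfl
  rw [hF, finsum_mem_union' hdisj (hfin.inter_of_right _) (hfin.inter_of_right _),
    finsum_mem_range he0, finsum_mem_range he1]
  simp only [F, hs0, hs1, rootSum, add_assoc]

lemma rootSum_lowerDiff {ℓ : ℕ} {Ψ : Finset (ℕ × ℕ)} (hΨ : Ψ ⊆ DeltaPlus ℓ) (c : ℕ)
    (γ : ℕ → ℤ) :
    rootSum (lowerDiff c (gg ℓ)) Ψ γ =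
      rootSum (gg ℓ) Ψ γ - rootSum (gg ℓ) Ψ (fun x => γ x - eps c x) := by
  unfold rootSum lowerDiff
  have h2 := finite_support_gg hΨ (fun x => γ x - eps c x)
  have hcomm : ∀ α : {p // p ∈ Ψ} → ℕ,
      (fun x => γ x - eps c x + rootShift Ψ α x) =
      (fun x => γ x + rootShift Ψ α x - eps c x) := fun α => by funext x; ring
  simp only [hcomm] at h2 ⊢
  exact finsum_sub_distrib (finite_support_gg hΨ γ) h2

lemma eps_swap (c i x : ℕ) :
    eps (Equiv.swap c (c + 1) i) x = eps i (Equiv.swap c (c + 1) x) := by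
  have : x = Equiv.swap c (c + 1) i ↔ Equiv.swap c (c + 1) x = i := by
    constructor <;> rintro rfl <;> simp
  simp only [eps, this]

lemma rootSum_dotSwap {f : (ℕ → ℤ) → R} {Ψ : Finset (ℕ × ℕ)} {c : ℕ}
    (hf : ∀ γ, f (dotSwap c γ) = - f γ)
    (hΨ : ∀ p : ℕ × ℕ, ((Equiv.swap c (c + 1)).prodCongr (Equiv.swap c (c + 1))) p ∈ Ψ ↔ p ∈ Ψ)
    (γ : ℕ → ℤ) : rootSum f Ψ (dotSwap c γ) = - rootSum f Ψ γ := by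
  let σ : Equiv.Perm {p // p ∈ Ψ} :=
    Equiv.Perm.subtypePerm ((Equiv.swap c (c + 1)).prodCongr (Equiv.swap c (c + 1))) hΨ
  let e : ({p // p ∈ Ψ} → ℕ) ≃ ({p // p ∈ Ψ} → ℕ) := Equiv.arrowCongr σ (Equiv.refl ℕ)
  rw [rootSum, rootSum, ← finsum_comp_equiv e, ← finsum_neg_distrib]
  refine finsum_congr fun α => ?_
  rw [← hf]
  congr 1
  funext x
  have hshift : rootShift Ψ (e α) x = rootShift Ψ α (Equiv.swap c (c + 1) x) := by
    rw [rootShift, rootShift, ← Finset.univ_eq_attach, ← Equiv.sum_comp σ]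
    refine Finset.sum_congr rfl fun q _ => ?_
    have h1 : e α (σ q) = α q := by simp [e, Equiv.arrowCongr]
    rw [h1]
    change _ * (eps (Equiv.swap c (c + 1) q.1.1) x - eps (Equiv.swap c (c + 1) q.1.2) x) = _
    rw [eps_swap, eps_swap]
  rw [hshift]
  simp only [dotSwap]
  ring

lemma katalan_eq_rootSum (ℓ : ℕ) (Ψ : Finset (ℕ × ℕ)) (M : Multiset ℕ) (γ : ℕ → ℤ) :
    katalan ℓ Ψ M γ = (M.powerset.map fun S => (-1 : R) ^ Multiset.card S *
      rootSum (gg ℓ) Ψ (fun x => γ x - (S.map fun z => eps z x).sum)).sum := by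
  unfold katalan rootSum rootShift
  simp only [sub_add_eq_add_sub]

lemma katalan_cons (ℓ : ℕ) (Ψ : Finset (ℕ × ℕ)) (M : Multiset ℕ) (c : ℕ) (γ : ℕ → ℤ) :
    katalan ℓ Ψ (c ::ₘ M) γ =
      katalan ℓ Ψ M γ - katalan ℓ Ψ M (fun x => γ x - eps c x) := by
  simp only [katalan_eq_rootSum, Multiset.powerset_cons, Multiset.map_add, Multiset.sum_add,
    Multiset.map_map, Function.comp_def, Multiset.card_cons, Multiset.map_cons,
    Multiset.sum_cons, pow_succ, mul_neg, mul_one, neg_mul, Multiset.sum_map_neg, sub_eq_add_neg,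
    neg_add, add_assoc]

lemma katalan_insert {ℓ : ℕ} {Ψ : Finset (ℕ × ℕ)} {p : ℕ × ℕ}
    (hΨ : insert p Ψ ⊆ DeltaPlus ℓ) (hp : p ∉ Ψ) (M : Multiset ℕ) (γ : ℕ → ℤ) :
    katalan ℓ (insert p Ψ) M γ = katalan ℓ Ψ M γ +
      katalan ℓ (insert p Ψ) M (fun x => γ x + (eps p.1 x - eps p.2 x)) := by
  simp only [katalan_eq_rootSum]
  rw [← Multiset.sum_map_add]
  congr 1
  refine Multiset.map_congr rfl fun S _ => ?_
  rw [← mul_add, rootSum_insert hΨ hp]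
  congr 3
  funext x
  ring

lemma powerset_map {α β : Type*} (g : α → β) (M : Multiset α) :
    (M.map g).powerset = M.powerset.map (Multiset.map g) := by
  induction M using Multiset.induction with
  | empty => simp
  | cons a M ih => simp [Multiset.powerset_cons, ih, Multiset.map_map]

lemma katalan_dotSwap {ℓ c : ℕ} (hc : 1 ≤ c) (hcl : c + 1 ≤ ℓ) {Ψ : Finset (ℕ × ℕ)}
    (hsub : Ψ ⊆ DeltaPlus ℓ) {M : Multiset ℕ}
    (hΨ : ∀ p : ℕ × ℕ, ((Equiv.swap c (c + 1)).prodCongr (Equiv.swap c (c + 1))) p ∈ Ψ ↔ p ∈ Ψ)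
    (hM : M.map (Equiv.swap c (c + 1)) = M) (γ : ℕ → ℤ) :
    katalan ℓ Ψ ((c + 1) ::ₘ M) (dotSwap c γ) = - katalan ℓ Ψ ((c + 1) ::ₘ M) γ := by
  have key : ∀ γ, katalan ℓ Ψ ((c + 1) ::ₘ M) γ = (M.powerset.map fun S =>
      (-1 : R) ^ Multiset.card S * rootSum (lowerDiff (c + 1) (gg ℓ)) Ψ
        (fun x => γ x - (S.map fun z => eps z x).sum)).sum := by
    intro γ
    rw [katalan_cons, katalan_eq_rootSum, katalan_eq_rootSum, ← Multiset.sum_map_sub]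
    congr 1
    refine Multiset.map_congr rfl fun S _ => ?_
    rw [← mul_sub, rootSum_lowerDiff hsub]
    congr 3
    funext x
    ring
  rw [key, key, ← Multiset.sum_map_neg]
  conv_lhs => rw [← hM, powerset_map]
  rw [Multiset.map_map]
  congr 1
  refine Multiset.map_congr rfl fun S _ => ?_
  rw [← mul_neg, ← rootSum_dotSwap (lowerDiff_gg_dotSwap hc hcl) hΨ]
  simp only [Function.comp_apply, Multiset.card_map]
  congr 2
  funext x
  simp only [Multiset.map_map, Function.comp_def, eps_swap, dotSwap]
  ring

lemma katalan_eq_zero_of_neg {ℓ : ℕ} (hℓ : 1 ≤ ℓ) {Ψ : Finset (ℕ × ℕ)} (hΨ : Ψ ⊆ DeltaPlus ℓ)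
    (M : Multiset ℕ) {γ : ℕ → ℤ} (hγ : γ ℓ < 0) : katalan ℓ Ψ M γ = 0 := by
  rw [katalan_eq_rootSum]
  refine Multiset.sum_eq_zero fun a ha => ?_
  obtain ⟨S, -, rfl⟩ := Multiset.mem_map.1 ha
  have hS : 0 ≤ (S.map fun z => eps z ℓ).sum := by
    refine Multiset.sum_nonneg fun a ha => ?_
    obtain ⟨z, -, rfl⟩ := Multiset.mem_map.1 ha
    unfold eps
    split_ifs <;> simp
  rw [rootSum, finsum_eq_zero_of_forall_eq_zero, mul_zero]
  intro α
  have hα : rootShift Ψ α ℓ ≤ 0 := by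
    refine Finset.sum_nonpos fun q _ => ?_
    have hq := hΨ q.2
    simp only [DeltaPlus, Finset.mem_filter, Finset.mem_product, Finset.mem_Icc] at hq
    have h1 : eps q.1.1 ℓ = 0 := if_neg (by omega)
    have h2 : 0 ≤ eps q.1.2 ℓ := by unfold eps; split_ifs <;> simp
    rw [h1]
    nlinarith [Int.natCast_nonneg (α q)]
  exact gg_eq_zero hℓ le_rfl (by omega)

/-- The set of positive roots `(i, j)` with `s i ≤ j`. -/
def rootsFrom (ℓ : ℕ) (s : ℕ → ℤ) : Finset (ℕ × ℕ) :=
  (DeltaPlus ℓ).filter fun p => s p.1 ≤ (p.2 : ℤ)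

/-- The Katalan function of two root sets given by the columns in which their rows start. -/
def rowKatalan (ℓ : ℕ) (s t : ℕ → ℤ) (γ : ℕ → ℤ) : R :=
  katalan ℓ (rootsFrom ℓ s) (Lmul (rootsFrom ℓ t)) γ

lemma mem_rootsFrom {ℓ : ℕ} {s : ℕ → ℤ} {p : ℕ × ℕ} :
    p ∈ rootsFrom ℓ s ↔ 1 ≤ p.1 ∧ p.1 < p.2 ∧ p.2 ≤ ℓ ∧ s p.1 ≤ (p.2 : ℤ) := by
  simp only [rootsFrom, DeltaPlus, Finset.mem_filter, Finset.mem_product, Finset.mem_Icc]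
  omega

lemma rootsFrom_subset (ℓ : ℕ) (s : ℕ → ℤ) : rootsFrom ℓ s ⊆ DeltaPlus ℓ :=
  Finset.filter_subset _ _

lemma rootsFrom_congr {ℓ : ℕ} {s s' : ℕ → ℤ}
    (h : ∀ i, 1 ≤ i → i ≤ ℓ → s i = s' i ∨ ((ℓ : ℤ) < s i ∧ (ℓ : ℤ) < s' i)) :
    rootsFrom ℓ s = rootsFrom ℓ s' := by
  ext p
  simp only [mem_rootsFrom]
  constructor
  · rintro ⟨h1, h2, h3, h4⟩
    have := h p.1 h1 (by omega)
    exact ⟨h1, h2, h3, by omega⟩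
  · rintro ⟨h1, h2, h3, h4⟩
    have := h p.1 h1 (by omega)
    exact ⟨h1, h2, h3, by omega⟩

lemma rootsFrom_eq_insert {ℓ i j : ℕ} {s s' : ℕ → ℤ} (h1 : 1 ≤ i) (hij : i < j) (hj : j ≤ ℓ)
    (hs : s i = j) (hi : s' i = j + 1) (hne : ∀ x, x ≠ i → s' x = s x) :
    (i, j) ∉ rootsFrom ℓ s' ∧ rootsFrom ℓ s = insert (i, j) (rootsFrom ℓ s') := by
  constructor
  · rw [mem_rootsFrom]
    simp only
    omega
  · ext ⟨a, b⟩
    simp only [Finset.mem_insert, mem_rootsFrom, Prod.mk.injEq]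
    by_cases ha : a = i
    · subst ha
      omega
    · have := hne a ha
      omega

lemma rowKatalan_add_root {ℓ i j : ℕ} {s s' : ℕ → ℤ} (t : ℕ → ℤ) (h1 : 1 ≤ i) (hij : i < j)
    (hj : j ≤ ℓ) (hs : s i = j) (hi : s' i = j + 1) (hne : ∀ x, x ≠ i → s' x = s x)
    (γ : ℕ → ℤ) :
    rowKatalan ℓ s t γ = rowKatalan ℓ s' t γ +
      rowKatalan ℓ s t (fun x => γ x + (eps i x - eps j x)) := by
  obtain ⟨hnot, heq⟩ := rootsFrom_eq_insert h1 hij hj hs hi hne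
  have hsub : insert (i, j) (rootsFrom ℓ s') ⊆ DeltaPlus ℓ := heq ▸ rootsFrom_subset ℓ s
  rw [rowKatalan, heq, katalan_insert hsub hnot, ← heq]
  rfl

lemma rowKatalan_lower {ℓ i j : ℕ} (s : ℕ → ℤ) {t t' : ℕ → ℤ} (h1 : 1 ≤ i) (hij : i < j)
    (hj : j ≤ ℓ) (ht : t i = j) (hi : t' i = j + 1) (hne : ∀ x, x ≠ i → t' x = t x)
    (γ : ℕ → ℤ) :
    rowKatalan ℓ s t γ = rowKatalan ℓ s t' γ - rowKatalan ℓ s t' (fun x => γ x - eps j x) := by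
  obtain ⟨hnot, heq⟩ := rootsFrom_eq_insert h1 hij hj ht hi hne
  have hL : Lmul (rootsFrom ℓ t) = j ::ₘ Lmul (rootsFrom ℓ t') := by
    rw [heq, Lmul, Lmul, Finset.insert_val_of_notMem hnot, Multiset.map_cons]
  rw [rowKatalan, hL, katalan_cons]
  rfl

lemma swap_cases (c j : ℕ) :
    (j = c ∧ Equiv.swap c (c + 1) j = c + 1) ∨ (j = c + 1 ∧ Equiv.swap c (c + 1) j = c) ∨
      (j ≠ c ∧ j ≠ c + 1 ∧ Equiv.swap c (c + 1) j = j) := by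
  by_cases h1 : j = c
  · subst h1
    exact Or.inl ⟨rfl, Equiv.swap_apply_left _ _⟩
  by_cases h2 : j = c + 1
  · subst h2
    exact Or.inr (Or.inl ⟨rfl, Equiv.swap_apply_right _ _⟩)
  · exact Or.inr (Or.inr ⟨h1, h2, Equiv.swap_apply_of_ne_of_ne h1 h2⟩)

lemma Lmul_map_swap {ℓ c : ℕ} (hcl : c + 1 ≤ ℓ) {t : ℕ → ℤ} (htc : (c : ℤ) + 1 < t c)
    (hcol : ∀ i, 1 ≤ i → i < c → t i ≠ c + 1) :
    (Lmul (rootsFrom ℓ t)).map (Equiv.swap c (c + 1)) = Lmul (rootsFrom ℓ t) := by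
  let e : ℕ × ℕ ≃ ℕ × ℕ := (Equiv.refl ℕ).prodCongr (Equiv.swap c (c + 1))
  have hmap : (rootsFrom ℓ t).map e.toEmbedding = rootsFrom ℓ t := by
    ext p
    rw [Finset.mem_map_equiv]
    obtain ⟨a, b⟩ := p
    have he : e.symm (a, b) = (a, Equiv.swap c (c + 1) b) := rfl
    rw [he, mem_rootsFrom, mem_rootsFrom]
    simp only
    by_cases hac : a = c
    · subst hac
      rcases swap_cases a b with ⟨h, h'⟩ | ⟨h, h'⟩ | ⟨h, h2, h'⟩ <;> rw [h'] <;> omega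
    · have := hcol a
      rcases swap_cases c b with ⟨h, h'⟩ | ⟨h, h'⟩ | ⟨h, h2, h'⟩ <;> rw [h'] <;> omega
  conv_rhs => rw [Lmul, ← hmap]
  rw [Finset.map_val, Multiset.map_map, Lmul, Multiset.map_map]
  rfl

lemma rowKatalan_dotSwap {ℓ c x : ℕ} (hcl : c + 1 ≤ ℓ) {s t : ℕ → ℤ}
    (hsc : (c : ℤ) + 1 < s c) (htc : (c : ℤ) + 1 < t c)
    (hcol : ∀ i, 1 ≤ i → i < c → s i ≠ c + 1)
    (hrow : ∀ j : ℕ, c + 1 < j → j ≤ ℓ → (s c ≤ j ↔ s (c + 1) ≤ j))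
    (hx : 1 ≤ x) (hxc : x < c) (htx : t x = c + 1)
    (huniq : ∀ i, 1 ≤ i → i < c → t i = c + 1 → i = x) (γ : ℕ → ℤ) :
    rowKatalan ℓ s t (dotSwap c γ) = - rowKatalan ℓ s t γ := by
  let t' : ℕ → ℤ := Function.update t x (c + 1 + 1)
  have hne : ∀ i, i ≠ x → t' i = t i := fun i hi => Function.update_of_ne hi _ _
  have htx' : t' x = c + 1 + 1 := Function.update_self _ _ _
  obtain ⟨hnot, heq⟩ := rootsFrom_eq_insert (ℓ := ℓ) (s := t) (s' := t') (j := c + 1) hx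
    (by omega) hcl (by push_cast; exact htx) (by push_cast; exact htx') hne
  have hL : Lmul (rootsFrom ℓ t) = (c + 1) ::ₘ Lmul (rootsFrom ℓ t') := by
    rw [heq, Lmul, Lmul, Finset.insert_val_of_notMem hnot, Multiset.map_cons]
  rw [rowKatalan, rowKatalan, hL]
  refine katalan_dotSwap (by omega) hcl (rootsFrom_subset _ _) ?_ ?_ γ
  · rintro ⟨a, b⟩
    change (Equiv.swap c (c + 1) a, Equiv.swap c (c + 1) b) ∈ _ ↔ _
    rw [mem_rootsFrom, mem_rootsFrom]
    simp only
    have hr := hrow b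
    rcases swap_cases c a with ⟨h, h'⟩ | ⟨h, h'⟩ | ⟨h, h2, h'⟩
    · rw [h', h]
      rcases swap_cases c b with ⟨g, g'⟩ | ⟨g, g'⟩ | ⟨g, g2, g'⟩ <;> rw [g'] <;> omega
    · rw [h', h]
      rcases swap_cases c b with ⟨g, g'⟩ | ⟨g, g'⟩ | ⟨g, g2, g'⟩ <;> rw [g'] <;> omega
    · rw [h']
      have := hcol a
      rcases swap_cases c b with ⟨g, g'⟩ | ⟨g, g'⟩ | ⟨g, g2, g'⟩ <;> rw [g'] <;> omega
  · refine Lmul_map_swap hcl (by rw [hne c (by omega)]; exact htc) fun i hi hic h => ?_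
    by_cases hix : i = x
    · subst hix
      omega
    · exact hix (huniq i hi hic (by rw [← hne i hix]; exact h))

lemma eq_zero_of_eq_neg {a : R} (h : a = -a) : a = 0 := by
  have h2 : (2 : ℚ) • a = 0 := by rw [two_smul]; nth_rewrite 1 [h]; simp
  exact (smul_eq_zero.1 h2).resolve_left two_ne_zero

/-- `F` is a combination of `K`-`k`-Schur functions whose coefficients alternate in sign with
respect to the degree `n`. -/
def IsAlternating (k ℓ : ℕ) (n : ℤ) (F : R) : Prop :=
  ∃ b : (ℕ → ℤ) →₀ ℤ, (∀ μ, b μ ≠ 0 → IsKBounded k ℓ μ) ∧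
    F = b.sum (fun μ a => a • kkschur k ℓ μ) ∧
    ∀ μ, 0 ≤ (-1 : ℚ) ^ (n - psize ℓ μ) * (b μ : ℚ)

lemma IsAlternating.zero (k ℓ : ℕ) (n : ℤ) : IsAlternating k ℓ n 0 :=
  ⟨0, by simp, by simp, by simp⟩

lemma IsAlternating.add {k ℓ : ℕ} {n : ℤ} {F G : R} (hF : IsAlternating k ℓ n F)
    (hG : IsAlternating k ℓ n G) : IsAlternating k ℓ n (F + G) := by
  obtain ⟨b, hb1, rfl, hb3⟩ := hF
  obtain ⟨b', hb1', rfl, hb3'⟩ := hG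
  refine ⟨b + b', fun μ hμ => ?_, ?_, fun μ => ?_⟩
  · by_cases h : b μ = 0
    · exact hb1' μ fun h' => hμ (by simp [h, h'])
    · exact hb1 μ h
  · rw [Finsupp.sum_add_index'] <;> simp [add_smul]
  · have := add_nonneg (hb3 μ) (hb3' μ)
    rw [Finsupp.add_apply]
    push_cast
    linarith

lemma IsAlternating.neg {k ℓ : ℕ} {n : ℤ} {F : R} (hF : IsAlternating k ℓ (n - 1) F) :
    IsAlternating k ℓ n (-F) := by
  obtain ⟨b, hb1, rfl, hb3⟩ := hF
  refine ⟨-b, fun μ hμ => hb1 μ (by simpa using hμ), ?_, fun μ => ?_⟩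
  · rw [Finsupp.sum_neg_index (by simp), Finsupp.sum, Finsupp.sum, ← Finset.sum_neg_distrib]
    simp
  · have h := hb3 μ
    have he : n - psize ℓ μ = (n - 1 - psize ℓ μ) + 1 := by ring
    rw [he, zpow_add_one₀ (by norm_num)]
    simpa using h

lemma IsAlternating.sub {k ℓ : ℕ} {n : ℤ} {F G : R} (hF : IsAlternating k ℓ n F)
    (hG : IsAlternating k ℓ (n - 1) G) : IsAlternating k ℓ n (F - G) := by
  rw [sub_eq_add_neg]
  exact hF.add hG.neg

lemma IsAlternating.kkschur {k ℓ : ℕ} {μ : ℕ → ℤ} (hμ : IsKBounded k ℓ μ) :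
    IsAlternating k ℓ (psize ℓ μ) (kkschur k ℓ μ) := by
  refine ⟨Finsupp.single μ 1, fun ν hν => ?_, by simp, fun ν => ?_⟩
  · by_cases h : μ = ν
    · exact h ▸ hμ
    · exact absurd (by simp [h]) hν
  · by_cases h : μ = ν
    · subst h
      simp
    · simp [h]

/-- The first column of row `i` of `Δ^k(μ)`. -/
def rowStart (k : ℕ) (μ : ℕ → ℤ) (i : ℕ) : ℤ := k - μ i + i + 1

/-- The row starts of `Δ^k(μ)` with the root `(y + 1, rowStart y)` added for each `y ∈ A`. -/
def markedStart (k : ℕ) (μ : ℕ → ℤ) (A : Finset ℕ) (i : ℕ) : ℤ :=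
  rowStart k μ i - if ∃ y ∈ A, y + 1 = i then 1 else 0

/-- The row starts of `Δ^k(μ)` with the first root of each row `i ≥ z` removed. -/
def weightStart (k z : ℕ) (μ : ℕ → ℤ) (i : ℕ) : ℤ :=
  rowStart k μ i + if z ≤ i then 1 else 0

lemma IsKBounded.antitone {k ℓ : ℕ} {μ : ℕ → ℤ} (hμ : IsKBounded k ℓ μ) {i j : ℕ} (hi : 1 ≤ i)
    (hij : i ≤ j) (hj : j ≤ ℓ) : μ j ≤ μ i := by
  induction j, hij using Nat.le_induction with
  | base => exact le_rfl
  | succ n hn ih => exact (hμ.2.1 n (by omega) (by omega)).trans (ih (by omega))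

lemma IsKBounded.le {k ℓ : ℕ} {μ : ℕ → ℤ} (hμ : IsKBounded k ℓ μ) {i : ℕ} (hi : 1 ≤ i)
    (hil : i ≤ ℓ) : μ i ≤ k :=
  (hμ.antitone le_rfl hi hil).trans hμ.1

lemma IsKBounded.rowStart_add_le {k ℓ : ℕ} {μ : ℕ → ℤ} (hμ : IsKBounded k ℓ μ) {i j : ℕ}
    (hi : 1 ≤ i) (hij : i ≤ j) (hj : j ≤ ℓ) : rowStart k μ i + j ≤ rowStart k μ j + i := by
  have := hμ.antitone hi hij hj
  unfold rowStart
  omega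

lemma rowStart_succ_eq_iff {k : ℕ} {μ : ℕ → ℤ} {i : ℕ} :
    rowStart k μ (i + 1) = rowStart k μ i + 1 ↔ μ i = μ (i + 1) := by
  unfold rowStart
  push_cast
  omega

lemma markedStart_of_forall {k : ℕ} {μ : ℕ → ℤ} {A : Finset ℕ} {i : ℕ}
    (h : ∀ y ∈ A, y + 1 ≠ i) : markedStart k μ A i = rowStart k μ i := by
  rw [markedStart, if_neg (by simpa using h), sub_zero]

lemma markedStart_succ {k : ℕ} {μ : ℕ → ℤ} {A : Finset ℕ} {y : ℕ} (h : y ∈ A) :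
    markedStart k μ A (y + 1) = rowStart k μ (y + 1) - 1 := by
  rw [markedStart, if_pos ⟨y, h, rfl⟩]

lemma markedStart_insert_of_ne {k : ℕ} {μ : ℕ → ℤ} {A : Finset ℕ} {a i : ℕ} (h : i ≠ a + 1) :
    markedStart k μ A i = markedStart k μ (insert a A) i := by
  simp [markedStart, h.symm]

lemma markedStart_empty (k : ℕ) (μ : ℕ → ℤ) : markedStart k μ ∅ = rowStart k μ :=
  funext fun _ => markedStart_of_forall (by simp)

lemma weightStart_of_le {k z : ℕ} {μ : ℕ → ℤ} {i : ℕ} (h : z ≤ i) :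
    weightStart k z μ i = rowStart k μ i + 1 := by
  rw [weightStart, if_pos h]

/-- A set of flat rows of `μ`, each of which is the first column of a row `w ≥ z` that is
either not flat or belongs to the set. -/
def IsMarking (k ℓ z : ℕ) (μ : ℕ → ℤ) (A : Finset ℕ) : Prop :=
  ∀ y ∈ A, μ y = μ (y + 1) ∧ (y : ℤ) + 2 ≤ rowStart k μ y ∧ rowStart k μ y ≤ ℓ ∧ y + 1 ∉ A ∧
    ∃ w, z ≤ w ∧ w < y ∧ rowStart k μ w = y ∧ (μ w = μ (w + 1) → w ∈ A)

lemma rowKatalan_marked_dotSwap {k ℓ z : ℕ} (hz : 1 ≤ z) {μ : ℕ → ℤ} (hμ : IsKBounded k ℓ μ)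
    {A : Finset ℕ} (hA : IsMarking k ℓ z μ A) {x c : ℕ} (hzx : z ≤ x) (hxc : x < c)
    (hc : rowStart k μ x = c) (hcl : c + 1 ≤ ℓ) (hx : μ x = μ (x + 1) → x ∈ A)
    (hpred : ∀ y ∈ A, y + 1 ≠ c) (hcc : (c : ℤ) + 2 ≤ rowStart k μ c)
    (hrow : ∀ j : ℕ, c + 1 < j → j ≤ ℓ →
      (rowStart k μ c ≤ j ↔ markedStart k μ A (c + 1) ≤ j)) (γ : ℕ → ℤ) :
    rowKatalan ℓ (markedStart k μ A) (weightStart k z μ) (dotSwap c γ) =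
      - rowKatalan ℓ (markedStart k μ A) (weightStart k z μ) γ := by
  have hsc : markedStart k μ A c = rowStart k μ c := markedStart_of_forall hpred
  have hnext : ∀ i, 1 ≤ i → i ≤ ℓ → rowStart k μ i = c + 1 →
      i = x + 1 ∧ x ∈ A := by
    intro i hi hil h
    have hxi : x < i := by
      by_contra hle
      have := hμ.rowStart_add_le hi (not_lt.1 hle) (by omega)
      omega
    have hle := hμ.rowStart_add_le (by omega) hxi.le hil
    have hix : i = x + 1 := by omega
    subst hix
    exact ⟨rfl, hx ((rowStart_succ_eq_iff (k := k)).1 (by omega))⟩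
  refine rowKatalan_dotSwap hcl (by omega) ?_ ?_ (by rwa [hsc]) (hz.trans hzx) hxc
    (by rw [weightStart_of_le hzx]; omega) ?_ γ
  · rw [weightStart_of_le (by omega)]
    omega
  · intro i hi hic h
    by_cases hmark : ∃ y ∈ A, y + 1 = i
    · obtain ⟨y, hy, rfl⟩ := hmark
      obtain ⟨hflat, -, -, -, w, hzw, hwy, -⟩ := hA y hy
      rw [markedStart_succ hy, rowStart_succ_eq_iff.2 hflat] at h
      obtain ⟨rfl, hxA⟩ := hnext y (by omega) (by omega) (by omega)
      exact (hA x hxA).2.2.2.1 hy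
    · have hmark' : ∀ y ∈ A, y + 1 ≠ i := fun y hy hyi => hmark ⟨y, hy, hyi⟩
      rw [markedStart_of_forall hmark'] at h
      obtain ⟨rfl, hxA⟩ := hnext i hi (by omega) h
      exact hmark' x hxA rfl
  · intro i hi hic h
    rcases lt_trichotomy i x with hlt | heq | hgt
    · have := hμ.rowStart_add_le hi hlt.le (by omega)
      rw [weightStart] at h
      split_ifs at h <;> omega
    · exact heq
    · have := hμ.rowStart_add_le (by omega) hgt.le (by omega)
      rw [weightStart_of_le (by omega)] at h
      omega

lemma IsMarking.rowKatalan_dotSwap {k ℓ z : ℕ} (hz : 1 ≤ z) {μ : ℕ → ℤ}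
    (hμ : IsKBounded k ℓ μ) {A : Finset ℕ} (hA : IsMarking k ℓ z μ A) {a : ℕ} (ha : a ∈ A)
    (γ : ℕ → ℤ) :
    rowKatalan ℓ (markedStart k μ A) (weightStart k z μ) (dotSwap a γ) =
      - rowKatalan ℓ (markedStart k μ A) (weightStart k z μ) γ := by
  obtain ⟨hflat, h2, hle, -, w, hzw, hwa, hw, hwA⟩ := hA a ha
  refine rowKatalan_marked_dotSwap hz hμ hA hzw hwa hw (by omega) hwA ?_ h2 ?_ γ
  · rintro y hy rfl
    exact (hA y hy).2.2.2.1 ha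
  · intro j _ _
    rw [markedStart_succ ha, rowStart_succ_eq_iff.2 hflat, add_sub_cancel_right]

lemma IsMarking.rowKatalan_insert {k ℓ z : ℕ} (hz : 1 ≤ z) {μ : ℕ → ℤ}
    (hμ : IsKBounded k ℓ μ) {A : Finset ℕ} {a j : ℕ} (hA : IsMarking k ℓ z μ (insert a A))
    (ha : a ∉ A) (hj : rowStart k μ a = j) (γ : ℕ → ℤ) :
    rowKatalan ℓ (markedStart k μ A) (weightStart k z μ) γ =
      rowKatalan ℓ (markedStart k μ (insert a A)) (weightStart k z μ) γ +
      rowKatalan ℓ (markedStart k μ (insert a A)) (weightStart k z μ)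
        (dotSwap a fun x => γ x + (eps (a + 1) x - eps j x)) := by
  obtain ⟨hflat, h2, hle, -, w, hzw, hwa, hw, hwA⟩ := hA a (Finset.mem_insert_self _ _)
  have hsucc := (rowStart_succ_eq_iff (k := k)).2 hflat
  rw [hA.rowKatalan_dotSwap hz hμ (Finset.mem_insert_self _ _),
    rowKatalan_add_root (s := markedStart k μ (insert a A)) (s' := markedStart k μ A)
      (i := a + 1) (j := j) _ (by omega) (by omega) (by omega) ?_ ?_ ?_ γ, add_neg_cancel_right]
  · rw [markedStart_succ (Finset.mem_insert_self _ _)]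
    omega
  · rw [markedStart_of_forall]
    · omega
    · intro y hy hya
      exact ha ((Nat.succ_injective hya) ▸ hy)
  · intro x hx
    exact markedStart_insert_of_ne hx

lemma dotSwap_eq_self {c : ℕ} {γ : ℕ → ℤ} (h : γ c = γ (c + 1) - 1) : dotSwap c γ = γ := by
  funext x
  simp only [dotSwap, eps]
  rcases swap_cases c x with ⟨rfl, h'⟩ | ⟨rfl, h'⟩ | ⟨h1, h2, h'⟩ <;> rw [h']
  · simp
    omega
  · simp
    omega
  · simp [h1, h2]

lemma IsMarking.rowKatalan_eq_zero {k ℓ z : ℕ} (hz : 1 ≤ z) {μ : ℕ → ℤ}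
    (hμ : IsKBounded k ℓ μ) {A : Finset ℕ} (hA : IsMarking k ℓ z μ A) {a : ℕ} (ha : a ∈ A)
    {γ : ℕ → ℤ} (hγ : γ a = γ (a + 1) - 1) :
    rowKatalan ℓ (markedStart k μ A) (weightStart k z μ) γ = 0 :=
  eq_zero_of_eq_neg (by
    have h := hA.rowKatalan_dotSwap hz hμ ha γ
    rwa [dotSwap_eq_self hγ] at h)

lemma eps_self (c : ℕ) : eps c c = 1 := if_pos rfl

lemma eps_of_ne {c x : ℕ} (h : x ≠ c) : eps c x = 0 := if_neg h

lemma IsMarking.rowKatalan_insert_of_eq {k ℓ z : ℕ} (hz : 1 ≤ z) {μ : ℕ → ℤ}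
    (hμ : IsKBounded k ℓ μ) {A : Finset ℕ} {a : ℕ} (hA : IsMarking k ℓ z μ (insert a A))
    (ha : a ∉ A) {γ : ℕ → ℤ} (hγ : γ a = γ (a + 1)) :
    rowKatalan ℓ (markedStart k μ A) (weightStart k z μ) γ =
      rowKatalan ℓ (markedStart k μ (insert a A)) (weightStart k z μ) γ := by
  have hm := hA a (Finset.mem_insert_self _ _)
  obtain ⟨j, hj⟩ := Int.eq_ofNat_of_zero_le (a := rowStart k μ a) (by omega)
  rw [hA.rowKatalan_insert hz hμ ha hj, add_eq_left,
    hA.rowKatalan_dotSwap hz hμ (Finset.mem_insert_self _ _), neg_eq_zero]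
  refine hA.rowKatalan_eq_zero hz hμ (Finset.mem_insert_self _ _) ?_
  simp only [eps_self, eps_of_ne (show a ≠ a + 1 by omega), eps_of_ne (show a ≠ j by omega),
    eps_of_ne (show a + 1 ≠ j by omega), hγ]
  ring

lemma IsMarking.rowKatalan_eq {k ℓ z : ℕ} (hz : 1 ≤ z) {μ : ℕ → ℤ} (hμ : IsKBounded k ℓ μ)
    {A : Finset ℕ} (hA : IsMarking k ℓ z μ A) :
    rowKatalan ℓ (markedStart k μ A) (weightStart k z μ) μ =
      rowKatalan ℓ (rowStart k μ) (weightStart k z μ) μ := by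
  induction A using Finset.induction_on_max with
  | empty => rw [markedStart_empty]
  | insert a A hmax ih =>
    have ha : a ∉ A := fun h => lt_irrefl _ (hmax a h)
    rw [← hA.rowKatalan_insert_of_eq hz hμ ha (hA a (Finset.mem_insert_self _ _)).1]
    refine ih fun y hy => ?_
    obtain ⟨h1, h2, h3, h4, w, hzw, hwy, hw, hwA⟩ := hA y (Finset.mem_insert_of_mem hy)
    refine ⟨h1, h2, h3, fun h => h4 (Finset.mem_insert_of_mem h), w, hzw, hwy, hw, fun h => ?_⟩
    have := hmax y hy
    exact (Finset.mem_insert.1 (hwA h)).resolve_left (by omega)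

lemma IsMarking.insert {k ℓ z : ℕ} {μ : ℕ → ℤ} {A : Finset ℕ} (hA : IsMarking k ℓ z μ A)
    {x c : ℕ} (hlt : ∀ y ∈ A, y + 1 < c) (hflat : μ c = μ (c + 1))
    (hcc : (c : ℤ) + 2 ≤ rowStart k μ c) (hle : rowStart k μ c ≤ ℓ) (hzx : z ≤ x) (hxc : x < c)
    (hx : rowStart k μ x = c) (hxA : μ x = μ (x + 1) → x ∈ A) :
    IsMarking k ℓ z μ (insert c A) := by
  intro y hy
  rcases Finset.mem_insert.1 hy with rfl | hy
  · refine ⟨hflat, hcc, hle, fun h => ?_, x, hzx, hxc, hx,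
      fun h => Finset.mem_insert_of_mem (hxA h)⟩
    have h' := hlt _ ((Finset.mem_insert.1 h).resolve_left (by omega))
    omega
  · obtain ⟨h1, h2, h3, h4, w, hzw, hwy, hw, hwA⟩ := hA y hy
    refine ⟨h1, h2, h3, fun h => ?_, w, hzw, hwy, hw, fun h => Finset.mem_insert_of_mem (hwA h)⟩
    have := hlt y hy
    exact h4 ((Finset.mem_insert.1 h).resolve_left (by omega))

lemma rowStart_sub_eps_of_ne {k : ℕ} {μ : ℕ → ℤ} {c i : ℕ} (h : i ≠ c) :
    rowStart k (fun x => μ x - eps c x) i = rowStart k μ i := by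
  simp only [rowStart, eps_of_ne h, sub_zero]

lemma rowStart_sub_eps_self (k : ℕ) (μ : ℕ → ℤ) (c : ℕ) :
    rowStart k (fun x => μ x - eps c x) c = rowStart k μ c + 1 := by
  simp only [rowStart, eps_self]
  ring

lemma IsMarking.sub_eps {k ℓ z : ℕ} {μ : ℕ → ℤ} {A : Finset ℕ} (hA : IsMarking k ℓ z μ A)
    {c : ℕ} (hlt : ∀ y ∈ A, y + 1 < c) : IsMarking k ℓ z (fun x => μ x - eps c x) A := by
  intro y hy
  have hyc := hlt y hy
  obtain ⟨h1, h2, h3, h4, w, hzw, hwy, hw, hwA⟩ := hA y hy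
  rw [rowStart_sub_eps_of_ne (by omega)]
  refine ⟨?_, h2, h3, h4, w, hzw, hwy, ?_, ?_⟩
  · simpa only [eps_of_ne (show y ≠ c by omega), eps_of_ne (show y + 1 ≠ c by omega), sub_zero]
  · rwa [rowStart_sub_eps_of_ne (by omega)]
  · simpa only [eps_of_ne (show w ≠ c by omega), eps_of_ne (show w + 1 ≠ c by omega), sub_zero]

lemma IsKBounded.sub_eps {k ℓ : ℕ} {μ : ℕ → ℤ} (hμ : IsKBounded k ℓ μ) {c : ℕ}
    (hlt : c < ℓ → μ (c + 1) < μ c) (hpos : c = ℓ → 0 < μ ℓ) :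
    IsKBounded k ℓ (fun x => μ x - eps c x) := by
  have hnn : ∀ x, 0 ≤ eps c x := fun x => by unfold eps; split_ifs <;> simp
  refine ⟨(sub_le_self _ (hnn 1)).trans hμ.1, fun i hi hil => ?_, ?_⟩
  · have h := hμ.2.1 i hi hil
    have h0 := hnn (i + 1)
    by_cases hic : i = c
    · subst hic
      have := hlt hil
      simp only [eps_self]
      omega
    · simp only [eps_of_ne hic]
      omega
  · by_cases hc : ℓ = c
    · have := hpos hc.symm
      subst hc
      simp only [eps_self]
      omega
    · simpa only [eps_of_ne hc, sub_zero] using hμ.2.2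

lemma psize_sub_eps {ℓ c : ℕ} (hc : 1 ≤ c) (hcl : c ≤ ℓ) (μ : ℕ → ℤ) :
    psize ℓ (fun x => μ x - eps c x) = psize ℓ μ - 1 := by
  simp only [psize, Finset.sum_sub_distrib, eps, Finset.sum_ite_eq', Finset.mem_Icc]
  rw [if_pos ⟨hc, hcl⟩]

lemma rowKatalan_congr {ℓ : ℕ} {s s' t t' γ : ℕ → ℤ}
    (hs : ∀ i, 1 ≤ i → i ≤ ℓ → s i = s' i ∨ ((ℓ : ℤ) < s i ∧ (ℓ : ℤ) < s' i))
    (ht : ∀ i, 1 ≤ i → i ≤ ℓ → t i = t' i ∨ ((ℓ : ℤ) < t i ∧ (ℓ : ℤ) < t' i)) :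
    rowKatalan ℓ s t γ = rowKatalan ℓ s' t' γ := by
  rw [rowKatalan, rootsFrom_congr hs, rootsFrom_congr ht, rowKatalan]

lemma markedStart_sub_eps_of_ne {k : ℕ} {μ : ℕ → ℤ} {A : Finset ℕ} {c i : ℕ} (h : i ≠ c) :
    markedStart k (fun x => μ x - eps c x) A i = markedStart k μ A i := by
  rw [markedStart, rowStart_sub_eps_of_ne h, markedStart]

lemma weightStart_sub_eps_of_ne {k z : ℕ} {μ : ℕ → ℤ} {c i : ℕ} (h : i ≠ c) :
    weightStart k z (fun x => μ x - eps c x) i = weightStart k z μ i := by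
  rw [weightStart, rowStart_sub_eps_of_ne h, weightStart]

lemma dotSwap_sub_eps {μ : ℕ → ℤ} {c j : ℕ} (hflat : μ c = μ (c + 1)) (hj : c + 2 ≤ j) :
    (dotSwap c fun x => μ x - eps c x + (eps (c + 1) x - eps j x)) = fun x => μ x - eps j x := by
  funext x
  simp only [dotSwap]
  rcases swap_cases c x with ⟨rfl, h'⟩ | ⟨rfl, h'⟩ | ⟨h1, h2, h'⟩ <;> rw [h']
  · simp only [eps_self, eps_of_ne (show x + 1 ≠ x by omega), eps_of_ne (show x ≠ x + 1 by omega),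
      eps_of_ne (show x ≠ j by omega), eps_of_ne (show x + 1 ≠ j by omega)]
    omega
  · simp only [eps_self, eps_of_ne (show c + 1 ≠ c by omega), eps_of_ne (show c ≠ c + 1 by omega),
      eps_of_ne (show c ≠ j by omega), eps_of_ne (show c + 1 ≠ j by omega)]
    omega
  · simp only [eps_of_ne h1, eps_of_ne h2]
    ring

/-- If all functions of weight `z` whose first `z` parts agree with those of `μ₀` expand with
alternating signs, then so does the function obtained by lowering the part `c` of `μ`, where `c`
is the first column of a row `x ≥ z`. -/
lemma isAlternating_lower {k ℓ z : ℕ} (hz : 1 ≤ z) {μ₀ : ℕ → ℤ}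
    (hP : ∀ ν, IsKBounded k ℓ ν → (∀ i ≤ z, ν i = μ₀ i) →
      IsAlternating k ℓ (psize ℓ ν) (rowKatalan ℓ (rowStart k ν) (weightStart k z ν) ν))
    {μ : ℕ → ℤ} (hμ : IsKBounded k ℓ μ) (hagree : ∀ i ≤ z, μ i = μ₀ i)
    (hk : rowStart k μ z < ℓ → ∀ i, z < i → i ≤ ℓ → μ i < k)
    {A : Finset ℕ} (hA : IsMarking k ℓ z μ A) {x c : ℕ} (hzx : z ≤ x) (hcl : c ≤ ℓ)
    (hc : rowStart k μ x = c) (hAx : ∀ y ∈ A, y ≤ x)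
    (hxA : c < ℓ → μ x = μ (x + 1) → x ∈ A) (hxc : x < c) :
    IsAlternating k ℓ (psize ℓ μ - 1)
      (rowKatalan ℓ (markedStart k μ A) (weightStart k z μ) (fun i => μ i - eps c i)) := by
  induction hn : ℓ - x using Nat.strong_induction_on generalizing μ A x c with
  | _ n ih =>
  have hlt : ∀ y ∈ A, y + 1 < c := by
    intro y hy
    rcases (hAx y hy).lt_or_eq with h | rfl
    · omega
    · have := (hA y hy).2.1
      omega
  have hcA : c ∉ A := fun h => by have := hlt c h; omega
  have hAc : ∀ y ∈ A, y ≤ c := fun y hy => by have := hlt y hy; omega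
  have hpred : ∀ y ∈ A, y + 1 ≠ c := fun y hy => (hlt y hy).ne
  have hcc : c < ℓ → (c : ℤ) + 2 ≤ rowStart k μ c := by
    intro h
    have h1 := hμ.rowStart_add_le hz hzx (by omega)
    have h2 := hk (by omega) c (by omega) hcl
    unfold rowStart
    omega
  have hcc' : (c : ℤ) + 1 ≤ rowStart k μ c := by
    have := hμ.le (i := c) (by omega) hcl
    unfold rowStart
    omega
  obtain ⟨j, hj⟩ := Int.eq_ofNat_of_zero_le (a := rowStart k μ c) (by omega)
  by_cases hflat : c < ℓ ∧ μ c = μ (c + 1)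
  · obtain ⟨hcl', hflat⟩ := hflat
    have hcc := hcc hcl'
    have hγ : μ c - eps c c = μ (c + 1) - eps c (c + 1) - 1 := by
      rw [eps_self, eps_of_ne (by omega), hflat]
      ring
    by_cases hjl : j ≤ ℓ
    · have hA' := hA.insert hlt hflat hcc (by omega) hzx hxc hc (hxA hcl')
      rw [hA'.rowKatalan_insert hz hμ hcA hj, dotSwap_sub_eps hflat (by omega),
        hA'.rowKatalan_eq_zero hz hμ (Finset.mem_insert_self _ _) hγ, zero_add]
      refine ih (ℓ - c) (by omega) hμ hagree hk hA' (by omega) hjl hj ?_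
        (fun _ _ => Finset.mem_insert_self _ _) (by omega) rfl
      intro y hy
      rcases Finset.mem_insert.1 hy with rfl | hy
      · exact le_rfl
      · exact hAc y hy
    · have hzero : rowKatalan ℓ (markedStart k μ A) (weightStart k z μ)
          (fun i => μ i - eps c i) = 0 := by
        have hsucc := (rowStart_succ_eq_iff (k := k)).2 hflat
        have hmark : markedStart k μ A (c + 1) = rowStart k μ (c + 1) :=
          markedStart_of_forall fun y hy => by have := hlt y hy; omega
        have h := rowKatalan_marked_dotSwap hz hμ hA hzx hxc hc hcl' (hxA hcl') hpred hcc
          (fun i _ _ => by omega) (fun i => μ i - eps c i)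
        rw [dotSwap_eq_self hγ] at h
        exact eq_zero_of_eq_neg h
      rw [hzero]
      exact IsAlternating.zero _ _ _
  have hnonflat : c < ℓ → μ (c + 1) < μ c := fun h =>
    lt_of_le_of_ne (hμ.2.1 c (by omega) h) fun h' => hflat ⟨h, h'.symm⟩
  by_cases hlast : c = ℓ ∧ μ ℓ ≤ 0
  · obtain ⟨rfl, h0⟩ := hlast
    rw [rowKatalan, katalan_eq_zero_of_neg (by omega) (rootsFrom_subset _ _)]
    · exact IsAlternating.zero _ _ _
    · simp only [eps_self]
      omega
  have hν := hμ.sub_eps hnonflat (fun h => lt_of_not_ge fun h' => hlast ⟨h, h'⟩)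
  have hsize := psize_sub_eps (by omega) hcl μ
  have hAν := hA.sub_eps hlt
  have hνc : rowStart k (fun x => μ x - eps c x) c = j + 1 := by
    rw [rowStart_sub_eps_self, hj]
  have hagreeν : ∀ i ≤ z, μ i - eps c i = μ₀ i := fun i hi => by
    rw [eps_of_ne (by omega), sub_zero, hagree i hi]
  have hbase := hP _ hν hagreeν
  rw [← hAν.rowKatalan_eq hz hν, hsize] at hbase
  have hmν : markedStart k (fun x => μ x - eps c x) A c = j + 1 := by
    rw [markedStart_of_forall hpred, hνc]
  have hmμ : markedStart k μ A c = j := by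
    rw [markedStart_of_forall hpred, hj]
  have hwν : weightStart k z (fun x => μ x - eps c x) c = j + 1 + 1 := by
    rw [weightStart_of_le (by omega), hνc]
  have hwμ : weightStart k z μ c = j + 1 := by
    rw [weightStart_of_le (by omega), hj]
  by_cases hjl : j ≤ ℓ
  · have hcl' : c < ℓ := by omega
    rw [rowKatalan_add_root (i := c) (j := j) (s' := markedStart k (fun x => μ x - eps c x) A) _
      (by omega) (by omega) hjl hmμ hmν fun i hi => markedStart_sub_eps_of_ne hi]
    have hγ : (fun i => μ i - eps c i + (eps c i - eps j i)) = fun i => μ i - eps j i := by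
      funext i
      ring
    rw [hγ]
    refine IsAlternating.add ?_ (ih (ℓ - c) (by omega) hμ hagree hk hA (by omega) hjl hj hAc
      (fun _ h => absurd h (hnonflat hcl').ne') (by omega) rfl)
    by_cases hjl' : j < ℓ
    · rw [rowKatalan_lower (i := c) (j := j + 1) (t := weightStart k z μ)
        (t' := weightStart k z fun x => μ x - eps c x) _ (by omega) (by omega) hjl'
        (by rw [hwμ]; push_cast; rfl) (by rw [hwν]; push_cast; rfl)
        fun i hi => weightStart_sub_eps_of_ne hi]
      refine hbase.sub ?_
      rw [← hsize]
      have hkν : rowStart k (fun x => μ x - eps c x) z < ℓ →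
          ∀ i, z < i → i ≤ ℓ → μ i - eps c i < k := by
        intro h i hi hil
        rw [rowStart_sub_eps_of_ne (by omega)] at h
        have := hk h i hi hil
        unfold eps
        split_ifs <;> omega
      by_cases hflatν : μ c - eps c c = μ (c + 1) - eps c (c + 1)
      · have hA' : IsMarking k ℓ z (fun x => μ x - eps c x) (insert c A) := by
          have hcc := hcc hcl'
          refine hAν.insert hlt hflatν (by omega) (by omega) hzx hxc ?_ ?_
          · rw [rowStart_sub_eps_of_ne (by omega), hc]
          · intro h
            by_cases hx1 : x + 1 = c
            · subst hx1
              rw [eps_of_ne (by omega), eps_self] at h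
              have := hμ.2.1 x (by omega) (by omega)
              omega
            · rw [eps_of_ne (by omega), eps_of_ne hx1, sub_zero, sub_zero] at h
              exact hxA hcl' h
        rw [hA'.rowKatalan_insert_of_eq hz hν hcA]
        · refine ih (ℓ - c) (by omega) hν hagreeν hkν hA' (by omega) hjl'
            (by rw [hνc]; push_cast; rfl) ?_ (fun _ _ => Finset.mem_insert_self _ _)
            (by omega) rfl
          intro y hy
          rcases Finset.mem_insert.1 hy with rfl | hy
          · exact le_rfl
          · exact hAc y hy
        · have hcc := hcc hcl'
          rw [hflatν, eps_of_ne (show c ≠ j + 1 by omega),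
            eps_of_ne (show c + 1 ≠ j + 1 by omega)]
      · exact ih (ℓ - c) (by omega) hν hagreeν hkν hAν (by omega) hjl'
          (by rw [hνc]; push_cast; rfl) hAc (fun _ h => absurd h hflatν) (by omega) rfl
    · refine (rowKatalan_congr (fun i _ _ => Or.inl rfl) fun i _ _ => ?_) ▸ hbase
      by_cases hic : i = c
      · subst hic
        omega
      · exact Or.inl (weightStart_sub_eps_of_ne hic)
  · refine (rowKatalan_congr (fun i _ _ => ?_) fun i _ _ => ?_) ▸ hbase
    · by_cases hic : i = c
      · subst hic
        omega
      · exact Or.inl (markedStart_sub_eps_of_ne hic)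
    · by_cases hic : i = c
      · subst hic
        omega
      · exact Or.inl (weightStart_sub_eps_of_ne hic)

lemma rootsFrom_rowStart (k ℓ : ℕ) (μ : ℕ → ℤ) : rootsFrom ℓ (rowStart k μ) = DeltaK k ℓ μ := by
  rw [rootsFrom, DeltaK]
  refine Finset.filter_congr fun p _ => ?_
  rw [rowStart]
  omega

lemma isAlternating_weight {k ℓ z : ℕ} (hz : 1 ≤ z) {μ : ℕ → ℤ} (hμ : IsKBounded k ℓ μ)
    (hstrict : ∀ x, 1 ≤ x → x < z → x + 1 ≤ ℓ → rowStart k μ x < ℓ → μ (x + 1) < μ x) :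
    IsAlternating k ℓ (psize ℓ μ) (rowKatalan ℓ (rowStart k μ) (weightStart k z μ) μ) := by
  induction z, hz using Nat.le_induction generalizing μ with
  | base =>
    have hw : rootsFrom ℓ (weightStart k 1 μ) = DeltaK (k + 1) ℓ μ := by
      rw [← rootsFrom_rowStart]
      refine rootsFrom_congr fun i hi _ => Or.inl ?_
      rw [weightStart_of_le hi, rowStart, rowStart]
      push_cast
      ring
    rw [rowKatalan, hw, rootsFrom_rowStart]
    exact IsAlternating.kkschur hμ
  | succ z hz ih =>
    have hprev := ih hμ fun x hx hxz => hstrict x hx (by omega)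
    have hne : ∀ i, i ≠ z → weightStart k z μ i = weightStart k (z + 1) μ i := by
      intro i hi
      rw [weightStart, weightStart]
      congr 2
      exact propext (by omega)
    have hzz : weightStart k (z + 1) μ z = rowStart k μ z := by
      rw [weightStart, if_neg (by omega), add_zero]
    by_cases hzl : z ≤ ℓ ∧ rowStart k μ z ≤ ℓ
    · obtain ⟨hzl, hd⟩ := hzl
      have hpos : (z : ℤ) + 1 ≤ rowStart k μ z := by
        have := hμ.le hz hzl
        unfold rowStart
        omega
      obtain ⟨j, hj⟩ := Int.eq_ofNat_of_zero_le (a := rowStart k μ z) (by omega)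
      rw [rowKatalan_lower (i := z) (j := j) (t' := weightStart k z μ) _ hz (by omega) (by omega)
        (by rw [hzz, hj]) (by rw [weightStart_of_le le_rfl, hj]) hne]
      refine hprev.sub ?_
      rw [← markedStart_empty]
      refine isAlternating_lower (μ₀ := μ) hz ?_ hμ (fun _ _ => rfl) ?_ (A := ∅)
        (fun y hy => absurd hy (Finset.notMem_empty y)) le_rfl (by omega) hj (by simp) ?_
        (by omega)
      · intro ν hν hagree
        refine ih hν fun x hx hxz hxl h => ?_
        rw [hagree _ hxz, hagree _ hxz.le]
        refine hstrict x hx (by omega) hxl ?_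
        rwa [rowStart, hagree _ hxz.le] at h
      · intro h i hi hil
        have h1 := hμ.antitone (i := z + 1) (by omega) hi hil
        have h2 := hstrict z hz (by omega) (by omega) h
        have h3 := hμ.le hz hzl
        omega
      · intro h hflat
        exact absurd hflat (hstrict z hz (by omega) (by omega) (by omega)).ne'
    · refine (rowKatalan_congr (fun i _ _ => Or.inl rfl) fun i _ hil => ?_) ▸ hprev
      by_cases hiz : i = z
      · subst hiz
        rw [weightStart_of_le le_rfl, hzz]
        omega
      · exact Or.inl (hne i hiz)

/-- the K-k-Schur alternating conjecture for λ ∈ Ŝ_ℓ^k. -/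
theorem statement1 (k ℓ : ℕ) (hℓ : 1 ≤ ℓ) (lam : ℕ → ℤ) (hlam : IsKBounded k ℓ lam)
    (hhat : ∀ x, 2 ≤ x → x ≤ ℓ → (k : ℤ) - lam x + (x : ℤ) < (ℓ : ℤ) → lam x < lam (x - 1)) :
    ∃ b : (ℕ → ℤ) → ℤ,
      (Function.support b).Finite ∧
      (∀ μ, b μ ≠ 0 → IsKBounded k ℓ μ) ∧
      closedkschur k ℓ lam = ∑ᶠ μ : ℕ → ℤ, b μ • kkschur k ℓ μ ∧
      ∀ μ, IsKBounded k ℓ μ →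
        0 ≤ (-1 : ℚ) ^ (psize ℓ lam - psize ℓ μ) * (b μ : ℚ) := by
  have hweight : rootsFrom ℓ (weightStart k (ℓ + 1) lam) = DeltaK k ℓ lam := by
    rw [← rootsFrom_rowStart]
    refine rootsFrom_congr fun i _ hil => Or.inl ?_
    rw [weightStart, if_neg (by omega), add_zero]
  have h := isAlternating_weight (z := ℓ + 1) (by omega) hlam fun x hx _ hxl hd => by
    by_contra hle
    have hs := hhat (x + 1) (by omega) hxl (by unfold rowStart at hd; push_cast; omega)
    exact hle hs
  rw [rowKatalan, hweight, rootsFrom_rowStart] at h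
  obtain ⟨b, hb, hsum, hsign⟩ := h
  refine ⟨b, b.hasFiniteSupport, hb, ?_, fun μ _ => hsign μ⟩
  rw [closedkschur, hsum, Finsupp.sum, finsum_eq_sum_of_support_subset]
  intro μ hμ
  simp only [Function.mem_support, Finset.mem_coe, Finsupp.mem_support_iff] at hμ ⊢
  exact fun h0 => hμ (by rw [h0, zero_smul])

end
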